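/- There exists a constant C > 0 such that for every integer n ≥ 2, every integer k with 2 ≤ k ≤ n, every real B ≥ 1, and every δ ∈ (0,1), there is a non-adaptive randomized algorithm making at most C · B² · n · log(k/δ) · log k subset queries, each query being a subset of size at most C · k, which, for every B-balanced k-clustering of an n-point set U, outputs exactly that partition with probability at least 1 − δ. -/

import Mathlib

open scoped ENNReal

/-- `count(S)`: the number of clusters (under the cluster labeling `c`) intersecting
the query set `S`. -/
def clusterCount {U K : Type*} [DecidableEq K] (c : U → K) (S : Finset U) : ℕ :=
  (S.image c).card

/-- A `k`-clustering of `Fin n` (given by the labeling `c`) is `B`-balanced if every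
cluster has size between `n/(Bk)` and `Bn/k`. -/
def IsBalanced {n k : ℕ} (B : ℝ) (c : Fin n → Fin k) : Prop :=
  ∀ j : Fin k,
    (n : ℝ) / (B * k) ≤ ((Finset.univ.filter (fun x => c x = j)).card : ℝ) ∧
    ((Finset.univ.filter (fun x => c x = j)).card : ℝ) ≤ B * n / k

theorem mul_pow_le_pow_sub_pow {x y : ℝ} (hy : 0 ≤ y) (hxy : y ≤ x) (s : ℕ) :
    (s + 1) * (x - y) * y ^ s ≤ x ^ (s + 1) - y ^ (s + 1) := by
  induction s with
  | zero => simp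
  | succ s ih =>
    have h1 : y * ((s + 1) * (x - y) * y ^ s) ≤ y * (x ^ (s + 1) - y ^ (s + 1)) :=
      mul_le_mul_of_nonneg_left ih hy
    have h2 : (x - y) * y ^ (s + 1) ≤ (x - y) * x ^ (s + 1) :=
      mul_le_mul_of_nonneg_left (pow_le_pow_left₀ hy hxy _) (sub_nonneg.2 hxy)
    push_cast
    calc ((s : ℝ) + 1 + 1) * (x - y) * y ^ (s + 1)
        = y * ((s + 1) * (x - y) * y ^ s) + (x - y) * y ^ (s + 1) := by ring
      _ ≤ y * (x ^ (s + 1) - y ^ (s + 1)) + (x - y) * x ^ (s + 1) := add_le_add h1 h2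
      _ = x ^ (s + 1 + 1) - y ^ (s + 1 + 1) := by ring

/-- The sample `f` hits cluster `i` and avoids cluster `j`. -/
def Separates {U K : Type*} {s : ℕ} (c : U → K) (f : Fin s → U) (i j : K) : Prop :=
  (∃ a, c (f a) = i) ∧ ∀ a, c (f a) ≠ j

open Classical in
theorem card_separates_add {n k s : ℕ} (c : Fin n → Fin k) (i j : Fin k) :
    (Finset.univ.filter fun f : Fin s → Fin n => Separates c f i j).card +
        (Finset.univ.filter fun x => c x ≠ i ∧ c x ≠ j).card ^ s =
      (Finset.univ.filter fun x => c x ≠ j).card ^ s := by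
  have key : ∀ T : Finset (Fin n),
      T.card ^ s = (Fintype.piFinset fun _ : Fin s => T).card := by
    intro T; simp [Fintype.card_piFinset]
  rw [key, key, ← Finset.card_union_of_disjoint]
  · congr 1
    ext f
    simp only [Finset.mem_union, Finset.mem_filter, Finset.mem_univ, true_and,
      Fintype.mem_piFinset]
    constructor
    · rintro (h | h)
      · exact h.2
      · exact fun a => (h a).2
    · intro h
      by_cases hi : ∃ a, c (f a) = i
      · exact Or.inl ⟨hi, h⟩
      · push Not at hi
        exact Or.inr fun a => ⟨hi a, h a⟩
  · rw [Finset.disjoint_left]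
    intro f hf hf'
    simp only [Finset.mem_filter, Finset.mem_univ, true_and,
      Fintype.mem_piFinset] at hf hf'
    obtain ⟨⟨a, ha⟩, -⟩ := hf
    exact (hf' a).1 ha

open Classical in
/-- A sample of about `k / (4 B)` points separates a given pair of clusters with probability at
least `1 / (8 B ^ 2)`. -/
theorem card_separates_ge {n k s : ℕ} (hn : 0 < n) (hk : 0 < k) {B : ℝ} (hB : 1 ≤ B)
    (hs : (s : ℝ) ≤ k / (4 * B)) (hs' : k / (4 * B) ≤ (s : ℝ) + 1)
    {c : Fin n → Fin k} (hc : IsBalanced B c) {i j : Fin k} (hij : i ≠ j) :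
    (n : ℝ) ^ (s + 1) * (1 / (8 * B ^ 2)) ≤
      (Finset.univ.filter fun f : Fin (s + 1) → Fin n => Separates c f i j).card := by
  have hcount := card_separates_add (s := s + 1) c i j
  set G := (Finset.univ.filter fun f : Fin (s + 1) → Fin n => Separates c f i j).card
  set P := (Finset.univ.filter fun x => c x = i).card with hP
  set Q := (Finset.univ.filter fun x => c x = j).card with hQ
  set X := (Finset.univ.filter fun x => c x ≠ j).card with hX
  set Y := (Finset.univ.filter fun x => c x ≠ i ∧ c x ≠ j).card with hY
  have h1 : Q + X = n := by
    simpa using Finset.card_filter_add_card_filter_not (s := Finset.univ) (fun x => c x = j)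
  have h2 : P + Y = X := by
    rw [hP, hY, hX, ← Finset.card_union_of_disjoint]
    · congr 1
      ext x
      simp only [Finset.mem_union, Finset.mem_filter, Finset.mem_univ, true_and]
      grind
    · rw [Finset.disjoint_left]
      intro x
      simp only [Finset.mem_filter, Finset.mem_univ, true_and]
      grind
  have h1' : (Q : ℝ) + X = n := by exact_mod_cast h1
  have h2' : (P : ℝ) + Y = X := by exact_mod_cast h2
  have hc' : (G : ℝ) + (Y : ℝ) ^ (s + 1) = (X : ℝ) ^ (s + 1) := by exact_mod_cast hcount
  have hn' : (0 : ℝ) < n := by exact_mod_cast hn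
  have hk' : (0 : ℝ) < k := by exact_mod_cast hk
  have hB' : 0 < B := by linarith
  have hPl : (n : ℝ) / (B * k) ≤ P := (hc i).1
  have hPu : (P : ℝ) ≤ B * n / k := (hc i).2
  have hQu : (Q : ℝ) ≤ B * n / k := (hc j).2
  have hY0 : (0 : ℝ) ≤ Y := Nat.cast_nonneg _
  have hP0 : (0 : ℝ) ≤ P := Nat.cast_nonneg _
  have main := mul_pow_le_pow_sub_pow hY0 (show (Y : ℝ) ≤ X by linarith) s
  have hYpow : (n : ℝ) ^ s / 2 ≤ (Y : ℝ) ^ s := by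
    have hratio : (Y : ℝ) = n * (1 + (Y / n - 1)) := by
      rw [add_sub_cancel, mul_div_cancel₀ _ hn'.ne']
    have hge : -2 ≤ (Y : ℝ) / n - 1 := by
      have := div_nonneg hY0 hn'.le
      linarith
    have hber := one_add_mul_le_pow hge s
    have hdef : -(2 * B / k) ≤ (Y : ℝ) / n - 1 := by
      have : (n : ℝ) - 2 * (B * n / k) ≤ Y := by linarith
      have h3 : ((n : ℝ) - 2 * (B * n / k)) / n ≤ Y / n := by gcongr
      have h4 : ((n : ℝ) - 2 * (B * n / k)) / n = 1 - 2 * B / k := by field_simp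
      linarith
    have hsm : (s : ℝ) * (2 * B / k) ≤ 1 / 2 := by
      calc (s : ℝ) * (2 * B / k) ≤ k / (4 * B) * (2 * B / k) := by gcongr
        _ = 1 / 2 := by field_simp; norm_num
    have hs0 : (0 : ℝ) ≤ s := Nat.cast_nonneg _
    have : (1 : ℝ) / 2 ≤ (1 + (Y / n - 1)) ^ s := by
      nlinarith [mul_le_mul_of_nonneg_left hdef hs0]
    rw [congrArg (· ^ s) hratio, mul_pow, div_eq_mul_one_div]
    gcongr
  calc (n : ℝ) ^ (s + 1) * (1 / (8 * B ^ 2))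
      = k / (4 * B) * (n / (B * k)) * (n ^ s / 2) := by field_simp; ring
    _ ≤ (s + 1) * (X - Y) * (Y : ℝ) ^ s := by
        have hXY : (X : ℝ) - Y = P := by linarith
        rw [hXY]
        gcongr
    _ ≤ G := by linarith

open Classical in
/-- All pairs of clusters are separated by some row for all but a `δ` fraction of the families of
samples. -/
theorem card_separating_ge {n k s t : ℕ} (hn : 0 < n) (hk : 0 < k) {B δ : ℝ} (hB : 1 ≤ B)
    (hδ : 0 < δ)
    (hs : (s : ℝ) ≤ k / (4 * B)) (hs' : k / (4 * B) ≤ (s : ℝ) + 1)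
    (ht : 8 * B ^ 2 * Real.log (k ^ 2 / δ) ≤ t)
    {c : Fin n → Fin k} (hc : IsBalanced B c) :
    (1 - δ) * ((n : ℝ) ^ (s + 1)) ^ t ≤
      (Finset.univ.filter fun F : Fin t → Fin (s + 1) → Fin n =>
        ∀ i j, i ≠ j → ∃ r, Separates c (F r) i j).card := by
  have hk' : (0 : ℝ) < k := by exact_mod_cast hk
  have hB' : 0 < B := by linarith
  set N : ℝ := (n : ℝ) ^ (s + 1) with hN
  have hN0 : 0 ≤ N := by positivity
  let bad : Fin k × Fin k → Finset (Fin t → Fin (s + 1) → Fin n) := fun p =>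
    Fintype.piFinset fun _ => Finset.univ.filter fun f => ¬ Separates c f p.1 p.2
  have hbad : ∀ p ∈ (Finset.univ : Finset (Fin k)).offDiag,
      ((bad p).card : ℝ) ≤ N ^ t * (δ / k ^ 2) := by
    intro p hp
    have hp' : p.1 ≠ p.2 := (Finset.mem_offDiag.1 hp).2.2
    have hge := card_separates_ge hn hk hB hs hs' hc hp'
    have hsum := Finset.card_filter_add_card_filter_not (s := Finset.univ)
      (fun f : Fin (s + 1) → Fin n => Separates c f p.1 p.2)
    have hsum' : ((Finset.univ.filter fun f : Fin (s + 1) → Fin n =>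
        Separates c f p.1 p.2).card : ℝ) + ((Finset.univ.filter fun f : Fin (s + 1) → Fin n =>
        ¬ Separates c f p.1 p.2).card : ℝ) = N := by
      rw [hN]
      rw [Finset.card_univ, Fintype.card_fun, Fintype.card_fin, Fintype.card_fin] at hsum
      exact_mod_cast hsum
    have hle : ((Finset.univ.filter fun f : Fin (s + 1) → Fin n =>
        ¬ Separates c f p.1 p.2).card : ℝ) ≤ N * Real.exp (-(1 / (8 * B ^ 2))) := by
      have := Real.add_one_le_exp (-(1 / (8 * B ^ 2)))
      nlinarith [mul_le_mul_of_nonneg_left this hN0]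
    have hcard : ((bad p).card : ℝ) = ((Finset.univ.filter fun f : Fin (s + 1) → Fin n =>
        ¬ Separates c f p.1 p.2).card : ℝ) ^ t := by
      simp [bad, Fintype.card_piFinset]
    rw [hcard]
    calc _ ≤ (N * Real.exp (-(1 / (8 * B ^ 2)))) ^ t := by gcongr
      _ = N ^ t * Real.exp (-(t / (8 * B ^ 2))) := by
          rw [mul_pow, ← Real.exp_nat_mul]; congr 2; ring
      _ ≤ N ^ t * (δ / k ^ 2) := by
          gcongr
          rw [← Real.le_log_iff_exp_le (by positivity)]
          have h1 : Real.log (k ^ 2 / δ) ≤ t / (8 * B ^ 2) := by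
            rw [le_div_iff₀ (by positivity)]; linarith
          have h2 : Real.log (δ / k ^ 2) = - Real.log (k ^ 2 / δ) := by
            rw [← Real.log_inv, inv_div]
          linarith
  set Good := Finset.univ.filter fun F : Fin t → Fin (s + 1) → Fin n =>
        ∀ i j, i ≠ j → ∃ r, Separates c (F r) i j with hGood
  have hcover : (Finset.univ : Finset (Fin t → Fin (s + 1) → Fin n)) ⊆
      Good ∪ (Finset.univ : Finset (Fin k)).offDiag.biUnion bad := by
    intro F _
    rw [Finset.mem_union]
    by_cases hF : F ∈ Good
    · exact Or.inl hF
    · right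
      simp only [hGood, Finset.mem_filter, Finset.mem_univ, true_and] at hF
      push Not at hF
      obtain ⟨i, j, hij, h⟩ := hF
      rw [Finset.mem_biUnion]
      exact ⟨(i, j), by simp [hij], by simpa [bad, Fintype.mem_piFinset] using h⟩
  have hcard := (Finset.card_le_card hcover).trans (Finset.card_union_le _ _)
  have hcard' : N ^ t ≤ (Good.card : ℝ) +
      (((Finset.univ : Finset (Fin k)).offDiag.biUnion bad).card : ℝ) := by
    rw [Finset.card_univ, Fintype.card_fun, Fintype.card_fun, Fintype.card_fin,
      Fintype.card_fin, Fintype.card_fin] at hcard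
    rw [hN]
    exact_mod_cast hcard
  have hunion : (((Finset.univ : Finset (Fin k)).offDiag.biUnion bad).card : ℝ) ≤ N ^ t * δ := by
    calc (((Finset.univ : Finset (Fin k)).offDiag.biUnion bad).card : ℝ)
        ≤ ∑ p ∈ (Finset.univ : Finset (Fin k)).offDiag, ((bad p).card : ℝ) := by
          exact_mod_cast Finset.card_biUnion_le
      _ ≤ (Finset.univ : Finset (Fin k)).offDiag.card • (N ^ t * (δ / k ^ 2)) :=
          Finset.sum_le_card_nsmul _ _ _ hbad
      _ ≤ (k ^ 2 : ℝ) * (N ^ t * (δ / k ^ 2)) := by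
          rw [nsmul_eq_mul]
          gcongr
          have : (Finset.univ : Finset (Fin k)).offDiag.card ≤ k ^ 2 := by
            rw [Finset.offDiag_card, Finset.card_univ, Fintype.card_fin, sq]
            exact Nat.sub_le _ _
          exact_mod_cast this
      _ = N ^ t * δ := by field_simp
  linarith

theorem clusterCount_insert_eq_iff {U K : Type*} [DecidableEq U] [DecidableEq K] (c : U → K)
    (S : Finset U) (x : U) :
    clusterCount c (insert x S) = clusterCount c S ↔ c x ∈ S.image c := by
  rw [clusterCount, clusterCount, Finset.image_insert]
  by_cases h : c x ∈ S.image c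
  · simp [Finset.insert_eq_of_mem h, h]
  · simp [Finset.card_insert_of_notMem h, h]

/-- The queries on a family of samples: each sample alone, and with each single point added. -/
def sampleQuery {n s t : ℕ} (F : Fin t → Fin s → Fin n) (p : Fin t × Option (Fin n)) :
    Finset (Fin n) :=
  p.2.elim (Finset.univ.image (F p.1)) fun x => insert x (Finset.univ.image (F p.1))

theorem card_sampleQuery_le {n s t : ℕ} (F : Fin t → Fin s → Fin n)
    (p : Fin t × Option (Fin n)) : (sampleQuery F p).card ≤ s + 1 := by
  have h : (Finset.univ.image (F p.1)).card ≤ s := by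
    simpa using Finset.card_image_le (s := Finset.univ) (f := F p.1)
  obtain ⟨r, _ | x⟩ := p
  · exact h.trans (Nat.le_succ s)
  · exact (Finset.card_insert_le _ _).trans (Nat.succ_le_succ h)

/-- Two points are identified when adding them changes the same sample counts. -/
def sampleDecode {n t : ℕ} (ans : Fin t × Option (Fin n) → ℕ) : Setoid (Fin n) :=
  Setoid.ker fun (x : Fin n) (r : Fin t) => ans (r, some x) = ans (r, none)

theorem sampleDecode_eq_ker {n k s t : ℕ} (c : Fin n → Fin k) (F : Fin t → Fin s → Fin n)
    (hF : ∀ i j, i ≠ j → ∃ r, Separates c (F r) i j) :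
    sampleDecode (fun p => clusterCount c (sampleQuery F p)) = Setoid.ker c := by
  ext x y
  have hiff : ∀ (r : Fin t) (z : Fin n),
      clusterCount c (sampleQuery F (r, some z)) = clusterCount c (sampleQuery F (r, none)) ↔
        ∃ a, c (F r a) = c z := by
    intro r z
    refine (clusterCount_insert_eq_iff c _ z).trans ?_
    simp
  have hdecode : sampleDecode (fun p => clusterCount c (sampleQuery F p)) x y ↔
      ∀ r, (∃ a, c (F r a) = c x) = ∃ a, c (F r a) = c y := by
    simp only [← hiff]
    exact ⟨fun h r => congrFun h r, fun h => funext h⟩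
  rw [hdecode, Setoid.ker_def]
  constructor
  · intro h
    by_contra hne
    obtain ⟨r, hhit, havoid⟩ := hF _ _ hne
    obtain ⟨a, ha⟩ := (h r).mp hhit
    exact havoid a ha
  · intro h r
    rw [h]

/-- There is a constant `C > 0` such that for all `n ≥ 2`, `2 ≤ k ≤ n`, `B ≥ 1`,
`δ ∈ (0,1)`, there is a non-adaptive randomized algorithm making at most
`C·B²·n·log₂(k/δ)·log₂ k` subset queries, each of size at most `C·k`, which for every
`B`-balanced `k`-clustering of an `n`-point set outputs exactly that partition with
probability at least `1 - δ`. -/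
theorem nonadaptive_balanced_clustering_second :
    ∃ C : ℝ, 0 < C ∧
      ∀ n k : ℕ, 2 ≤ n → 2 ≤ k → k ≤ n →
        ∀ B : ℝ, 1 ≤ B →
          ∀ δ : ℝ, 0 < δ → δ < 1 →
            ∃ m : ℕ,
              (m : ℝ) ≤ C * B ^ 2 * n * Real.logb 2 (k / δ) * Real.logb 2 k ∧
              ∃ D : PMF ((Fin m → Finset (Fin n)) × ((Fin m → ℕ) → Setoid (Fin n))),
                (∀ a ∈ D.support, ∀ i : Fin m, ((a.1 i).card : ℝ) ≤ C * k) ∧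
                ∀ c : Fin n → Fin k, IsBalanced B c →
                  ENNReal.ofReal (1 - δ) ≤
                    D.toOuterMeasure
                      {a | a.2 (fun i => clusterCount c (a.1 i)) = Setoid.ker c} := by
  classical
  refine ⟨34, by norm_num, fun n k hn hk hkn B hB δ hδ hδ1 => ?_⟩
  have hn' : (2 : ℝ) ≤ n := by exact_mod_cast hn
  have hk' : (2 : ℝ) ≤ k := by exact_mod_cast hk
  have hB' : 0 < B := by linarith
  have : NeZero n := ⟨by omega⟩
  set s : ℕ := ⌊(k : ℝ) / (4 * B)⌋₊
  set t : ℕ := ⌈16 * B ^ 2 * Real.log (k / δ)⌉₊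
  have hs : (s : ℝ) ≤ k / (4 * B) := Nat.floor_le (by positivity)
  have hs' : k / (4 * B) ≤ (s : ℝ) + 1 := (Nat.lt_floor_add_one _).le
  have hkδ : 2 ≤ k / δ := by rw [le_div_iff₀ hδ]; nlinarith
  have hlog0 : 0 < Real.log (k / δ) := Real.log_pos (by linarith)
  have ht : 8 * B ^ 2 * Real.log (k ^ 2 / δ) ≤ t := by
    have h1 : Real.log (k ^ 2 / δ) ≤ 2 * Real.log (k / δ) := by
      rw [← Real.log_rpow (by linarith)]
      apply Real.log_le_log (by positivity)
      rw [Real.rpow_two, div_pow]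
      gcongr
      nlinarith
    calc 8 * B ^ 2 * Real.log (k ^ 2 / δ) ≤ 8 * B ^ 2 * (2 * Real.log (k / δ)) := by gcongr
      _ = 16 * B ^ 2 * Real.log (k / δ) := by ring
      _ ≤ t := Nat.le_ceil _
  have htu : (t : ℝ) ≤ 17 * B ^ 2 * Real.logb 2 (k / δ) := by
    have h1 : (t : ℝ) < 16 * B ^ 2 * Real.log (k / δ) + 1 := Nat.ceil_lt_add_one (by positivity)
    have h2 : Real.log (k / δ) ≤ Real.logb 2 (k / δ) := by
      rw [Real.logb, le_div_iff₀ (Real.log_pos (by norm_num))]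
      nlinarith [Real.log_two_lt_d9]
    have h3 : 1 ≤ Real.logb 2 (k / δ) := by
      rw [Real.le_logb_iff_rpow_le (by norm_num) (by linarith)]
      simpa using hkδ
    have h4 : 16 * B ^ 2 * Real.log (k / δ) ≤ 16 * B ^ 2 * Real.logb 2 (k / δ) := by gcongr
    have h5 : 1 ≤ B ^ 2 * Real.logb 2 (k / δ) :=
      one_le_mul_of_one_le_of_one_le (one_le_pow₀ hB) h3
    linarith
  have hlogk : 1 ≤ Real.logb 2 k := by
    rw [Real.le_logb_iff_rpow_le (by norm_num) (by linarith)]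
    simpa using hk'
  let e : Fin t × Option (Fin n) ≃ Fin (t * (n + 1)) :=
    Fintype.equivFinOfCardEq (by simp)
  refine ⟨t * (n + 1), ?_,
    (PMF.uniformOfFintype (Fin t → Fin (s + 1) → Fin n)).map fun F =>
      (fun q => sampleQuery F (e.symm q), fun ans => sampleDecode fun p => ans (e p)), ?_, ?_⟩
  · push_cast
    calc (t : ℝ) * (n + 1) ≤ (17 * B ^ 2 * Real.logb 2 (k / δ)) * (2 * n) := by
          have : (n : ℝ) + 1 ≤ 2 * n := by linarith
          have := t.cast_nonneg.trans htu
          gcongr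
      _ = 34 * B ^ 2 * n * Real.logb 2 (k / δ) * 1 := by ring
      _ ≤ 34 * B ^ 2 * n * Real.logb 2 (k / δ) * Real.logb 2 k := by
          have : 0 ≤ Real.logb 2 (k / δ) := Real.logb_nonneg (by norm_num) (by linarith)
          gcongr
  · intro a ha q
    rw [PMF.mem_support_map_iff] at ha
    obtain ⟨F, -, rfl⟩ := ha
    have h1 : ((sampleQuery F (e.symm q)).card : ℝ) ≤ s + 1 + 1 := by
      exact_mod_cast card_sampleQuery_le F (e.symm q)
    have h2 : (k : ℝ) / (4 * B) ≤ k := div_le_self (by linarith) (by linarith)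
    change ((sampleQuery F (e.symm q)).card : ℝ) ≤ 34 * k
    linarith
  · intro c hc
    rw [PMF.toOuterMeasure_map_apply]
    have hcard := card_separating_ge (t := t) (by omega) (by omega) hB hδ hs hs' ht hc
    set Good := Finset.univ.filter fun F : Fin t → Fin (s + 1) → Fin n =>
        ∀ i j, i ≠ j → ∃ r, Separates c (F r) i j with hGood
    have hsub : (Good : Set (Fin t → Fin (s + 1) → Fin n)) ⊆ (fun F =>
        ((fun q => sampleQuery F (e.symm q), fun ans => sampleDecode fun p => ans (e p)) :
          (Fin (t * (n + 1)) → Finset (Fin n)) ×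
            ((Fin (t * (n + 1)) → ℕ) → Setoid (Fin n)))) ⁻¹'
        {a | a.2 (fun i => clusterCount c (a.1 i)) = Setoid.ker c} := by
      intro F hF
      have hF' : ∀ i j, i ≠ j → ∃ r, Separates c (F r) i j := by
        simpa [hGood] using hF
      simpa using sampleDecode_eq_ker c F hF'
    refine le_trans ?_ (MeasureTheory.measure_mono hsub)
    rw [PMF.toOuterMeasure_uniformOfFintype_apply]
    have hN : (0 : ℝ) < ((n : ℝ) ^ (s + 1)) ^ t := by positivity
    have h1 : 1 - δ ≤ (Good.card : ℝ) / ((n : ℝ) ^ (s + 1)) ^ t := (le_div_iff₀ hN).2 hcard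
    refine (ENNReal.ofReal_le_ofReal h1).trans (le_of_eq ?_)
    rw [ENNReal.ofReal_div_of_pos hN]
    simp
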